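/- arXiv:1903.06955 — 2 statements merged into one kernel-verified Lean document; each statement's English description precedes it below -/
import Mathlib

section
/- Let A ⊆ ℝ^d be a nonempty closed set with reach at least τ > 0 (every z with infDist(z, A) < τ has a unique nearest point in A). Let x, u ∈ ℝ^d each have a unique nearest point in A, with d_A(x) < τ and ‖x − u‖ ≤ τ − d_A(x). Write B := d_A(x)(2τ − d_A(x)) and A₀ := ‖u − x‖² + B (note A₀ ≤ τ²). Then ‖x − π_A(u)‖ ≤ √( 2τ·A₀ / (τ + √(τ² − A₀)) − B ). Moreover, this quantity is bounded above by both √( τ(2‖u − x‖² + B) / (τ + √(τ² − A₀)) ) and √( (√A₀ + ((√2 − 1)/τ)·A₀)² − B ). -/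
open Metric in
theorem near_cont {d : ℕ} {A : Set (EuclideanSpace ℝ (Fin d))} (hAcl : IsClosed A)
    (y p : EuclideanSpace ℝ (Fin d)) (hp : p ∈ A)
    (huniq : ∀ q, q ∈ A → dist y q = infDist y A → q = p) (η : ℝ) (hη : 0 < η) :
    ∃ δ > 0, ∀ z, dist z y < δ → ∀ q ∈ A, dist z q = infDist z A → dist q p < η := by
  set K : Set (EuclideanSpace ℝ (Fin d)) :=
    (closedBall y (infDist y A + 2) ∩ A) ∩ (ball p η)ᶜ with hK
  have hKc : IsCompact K :=
    ((isCompact_closedBall _ _).inter_right hAcl).inter_right isOpen_ball.isClosed_compl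
  have key : ∀ z, ∀ q ∈ A, dist z q = infDist z A → dist y q ≤ infDist y A + 2 * dist z y := by
    intro z q hq h
    have h1 := infDist_le_infDist_add_dist (x := z) (y := y) (s := A)
    have h2 := dist_triangle_left y q z
    linarith
  rcases K.eq_empty_or_nonempty with h | h
  · refine ⟨1, one_pos, fun z hz q hq h1 => ?_⟩
    by_contra hcon
    have : q ∈ K := by
      refine ⟨⟨?_, hq⟩, by simpa using hcon⟩
      rw [mem_closedBall, dist_comm]
      have := key z q hq h1
      linarith
    rw [h] at this
    exact this
  · obtain ⟨m, hm, hmin⟩ := hKc.exists_isMinOn h (f := fun q => dist y q) (by fun_prop)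
    have hlt : infDist y A < dist y m := by
      rcases (infDist_le_dist_of_mem (x := y) hm.1.2).lt_or_eq with h1 | h1
      · exact h1
      · exfalso
        have := huniq m hm.1.2 h1.symm
        apply hm.2
        rw [this]
        exact mem_ball_self hη
    refine ⟨min 1 ((dist y m - infDist y A) / 2), by
      apply lt_min one_pos; linarith, fun z hz q hq h1 => ?_⟩
    have hz1 := hz.trans_le (min_le_left _ _)
    have hz2 := hz.trans_le (min_le_right _ _)
    by_contra hcon
    have hqK : q ∈ K := by
      refine ⟨⟨?_, hq⟩, by simpa using hcon⟩
      rw [mem_closedBall, dist_comm]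
      have := key z q hq h1
      linarith
    have h2 : dist y m ≤ dist y q := hmin hqK
    have := key z q hq h1
    linarith

open Metric in
theorem reach_slope {d : ℕ} {A : Set (EuclideanSpace ℝ (Fin d))} (hAne : A.Nonempty)
    (hAcl : IsClosed A) (y p : EuclideanSpace ℝ (Fin d)) (hp : p ∈ A)
    (hyp : dist y p = infDist y A) (hpos : 0 < infDist y A)
    (huniq : ∀ q, q ∈ A → dist y q = infDist y A → q = p) (ε : ℝ) (hε : 0 < ε) (hε1 : ε < 1)
    (ρ : ℝ) (hρ : 0 < ρ) :
    ∃ z, z ≠ y ∧ dist z y < ρ ∧ infDist y A + (1 - ε) * dist z y < infDist z A := by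
  set D := infDist y A with hD
  obtain ⟨δ, hδ, H⟩ := near_cont hAcl y p hp huniq (ε * D) (by positivity)
  set v := (1 / D) • (y - p) with hv
  have hnyp : ‖y - p‖ = D := by rw [← dist_eq_norm]; exact hyp
  have hvn : ‖v‖ = 1 := by
    rw [hv, norm_smul, hnyp, Real.norm_of_nonneg (by positivity)]
    field_simp
  have hvy : inner ℝ v (y - p) = D := by
    rw [hv, real_inner_smul_left, real_inner_self_eq_norm_sq, hnyp]
    field_simp
  set t := min δ ρ / 2 with ht
  have htpos : 0 < t := by have := lt_min hδ hρ; linarith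
  have ht1 : t < δ := by have := min_le_left δ ρ; linarith
  have ht2 : t < ρ := by have := min_le_right δ ρ; linarith
  have hdz : dist (y + t • v) y = t := by
    rw [dist_eq_norm, add_sub_cancel_left, norm_smul, hvn, Real.norm_of_nonneg htpos.le, mul_one]
  refine ⟨y + t • v, ?_, by rw [hdz]; exact ht2, ?_⟩
  · intro h
    rw [h, dist_self] at hdz
    linarith
  obtain ⟨q, hq, hq1⟩ := hAcl.exists_infDist_eq_dist hAne (y + t • v)
  have hqp := H _ (by rw [hdz]; exact ht1) q hq hq1.symm
  rw [hdz, hq1, dist_eq_norm]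
  have e1 : ‖y + t • v - q‖ ^ 2 = ‖y - q‖ ^ 2 + 2 * t * inner ℝ v (y - q) + t ^ 2 := by
    have : y + t • v - q = (y - q) + t • v := by abel
    rw [this, norm_add_sq_real, norm_smul, hvn, Real.norm_of_nonneg htpos.le,
      real_inner_smul_right, real_inner_comm]
    ring
  have e2 : D ≤ ‖y - q‖ := by rw [← dist_eq_norm]; exact infDist_le_dist_of_mem hq
  have e3 : (1 - ε) * D ≤ inner ℝ v (y - q) := by
    have h1 : y - q = (y - p) - (q - p) := by abel
    have h2 := real_inner_le_norm v (q - p)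
    rw [h1, inner_sub_right, hvy]
    rw [hvn, ← dist_eq_norm] at h2
    linarith
  have e4 : D ^ 2 ≤ ‖y - q‖ ^ 2 := by gcongr
  have e5 : t * ((1 - ε) * D) ≤ t * inner ℝ v (y - q) := by gcongr
  have e6 : 0 < t ^ 2 * (ε * (2 - ε)) := by
    have : 0 < 2 - ε := by linarith
    positivity
  apply lt_of_pow_lt_pow_left₀ 2 (norm_nonneg _)
  nlinarith

open Metric in
theorem climb {d : ℕ} {A : Set (EuclideanSpace ℝ (Fin d))} (hAne : A.Nonempty)
    (hAcl : IsClosed A) (τ : ℝ)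
    (hreach : ∀ z : EuclideanSpace ℝ (Fin d), infDist z A < τ →
      ∃! p, p ∈ A ∧ dist z p = infDist z A)
    (u : EuclideanSpace ℝ (Fin d)) (hpos : 0 < infDist u A) (h : ℝ) (hh : 0 < h)
    (hlt : infDist u A + h < τ) (ε : ℝ) (hε : 0 < ε) (hε1 : ε < 1) :
    ∃ y ∈ sphere u h, infDist u A + (1 - ε) * h ≤ infDist y A := by
  obtain ⟨y, hy, hmax⟩ := (isCompact_closedBall u h).exists_isMaxOn
    (f := fun y => infDist y A - (1 - ε) * dist y u) ⟨u, mem_closedBall_self hh.le⟩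
    (((continuous_infDist_pt A).sub (by fun_prop)).continuousOn)
  have hu : infDist u A ≤ infDist y A - (1 - ε) * dist y u := by
    have := hmax (mem_closedBall_self hh.le)
    simpa using this
  rcases (mem_closedBall.1 hy).lt_or_eq with h1 | h1
  · exfalso
    have hypos : 0 < infDist y A := by
      have : 0 ≤ (1 - ε) * dist y u := mul_nonneg (by linarith) dist_nonneg
      linarith
    have hylt : infDist y A < τ := by
      have := infDist_le_infDist_add_dist (x := y) (y := u) (s := A)
      linarith
    obtain ⟨p, ⟨hp, hp1⟩, hp2⟩ := hreach y hylt
    obtain ⟨z, hz, hz1, hz2⟩ := reach_slope hAne hAcl y p hp hp1 hypos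
      (fun q hq hq1 => hp2 q ⟨hq, hq1⟩) ε hε hε1 (h - dist y u) (by linarith)
    have ht := dist_triangle z y u
    have hzb : z ∈ closedBall u h := by
      rw [mem_closedBall]; linarith
    have := hmax hzb
    simp only [Set.mem_ofPred_eq] at this
    have : (1 - ε) * dist z u ≤ (1 - ε) * (dist z y + dist y u) :=
      mul_le_mul_of_nonneg_left ht (by linarith)
    linarith
  · refine ⟨y, h1, ?_⟩
    rw [h1] at hu
    linarith

open Metric in
theorem extend {d : ℕ} {A : Set (EuclideanSpace ℝ (Fin d))} (hAne : A.Nonempty)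
    (hAcl : IsClosed A) (τ : ℝ)
    (hreach : ∀ z : EuclideanSpace ℝ (Fin d), infDist z A < τ →
      ∃! p, p ∈ A ∧ dist z p = infDist z A)
    (u p : EuclideanSpace ℝ (Fin d)) (hp : p ∈ A) (hup : dist u p = infDist u A)
    (hpos : 0 < infDist u A) (h : ℝ) (hh : 0 < h)
    (hlt : infDist u A + h < τ) :
    infDist u A + h ≤ infDist (u + (h / infDist u A) • (u - p)) A := by
  obtain ⟨y0, hy0, -⟩ := climb hAne hAcl τ hreach u hpos h hh hlt (1/2) (by norm_num) (by norm_num)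
  obtain ⟨y, hy, hmax⟩ := (isCompact_sphere u h).exists_isMaxOn
    (f := fun y => infDist y A) ⟨y0, hy0⟩ (continuous_infDist_pt A).continuousOn
  have hge : infDist u A + h ≤ infDist y A := by
    by_contra hcon
    push Not at hcon
    set g := min (1/2) ((infDist u A + h - infDist y A) / (2 * h)) with hg
    have hgpos : 0 < g := lt_min (by norm_num) (div_pos (by linarith) (by linarith))
    have hg1 : g ≤ 1 / 2 := min_le_left _ _
    have hg2 : g ≤ (infDist u A + h - infDist y A) / (2 * h) := min_le_right _ _
    obtain ⟨w, hw, hw1⟩ := climb hAne hAcl τ hreach u hpos h hh hlt g hgpos (by linarith)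
    have h2 : infDist w A ≤ infDist y A := hmax hw
    rw [le_div_iff₀ (by linarith)] at hg2
    nlinarith
  set s := infDist u A with hs
  have n1 : ‖y - u‖ = h := by rw [← dist_eq_norm]; exact hy
  have n2 : ‖u - p‖ = s := by rw [← dist_eq_norm]; exact hup
  have n3 : s + h ≤ ‖(y - u) + (u - p)‖ := by
    have : (y - u) + (u - p) = y - p := by abel
    rw [this, ← dist_eq_norm]
    exact hge.trans (infDist_le_dist_of_mem hp)
  have n4 : h * s ≤ inner ℝ (y - u) (u - p) := by
    have h1 := norm_add_sq_real (y - u) (u - p)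
    have h2 : (s + h) ^ 2 ≤ ‖(y - u) + (u - p)‖ ^ 2 := by gcongr
    rw [n1, n2] at h1
    nlinarith
  have n5 : ‖(y - u) - (h / s) • (u - p)‖ ^ 2 ≤ 0 := by
    rw [norm_sub_sq_real, norm_smul, real_inner_smul_right, n1, n2,
      Real.norm_of_nonneg (by positivity), div_mul_cancel₀ _ hpos.ne']
    have : h / s * (h * s) ≤ h / s * inner ℝ (y - u) (u - p) := by gcongr
    have h3 : h / s * (h * s) = h ^ 2 := by field_simp
    nlinarith
  have n6 : (y - u) - (h / s) • (u - p) = 0 := by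
    rw [← norm_eq_zero]
    exact pow_eq_zero_iff (two_ne_zero) |>.1 (le_antisymm n5 (by positivity))
  have : u + (h / s) • (u - p) = y := by
    rw [sub_eq_zero] at n6
    rw [← n6]; abel
  rw [this]
  exact hge

open Metric in
theorem extend_tau {d : ℕ} {A : Set (EuclideanSpace ℝ (Fin d))} (hAne : A.Nonempty)
    (hAcl : IsClosed A) (τ : ℝ)
    (hreach : ∀ z : EuclideanSpace ℝ (Fin d), infDist z A < τ →
      ∃! p, p ∈ A ∧ dist z p = infDist z A)
    (u p : EuclideanSpace ℝ (Fin d)) (hp : p ∈ A) (hup : dist u p = infDist u A)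
    (hpos : 0 < infDist u A) (hlt : infDist u A < τ) :
    τ ≤ infDist (u + ((τ - infDist u A) / infDist u A) • (u - p)) A := by
  set s := infDist u A with hs
  have hc : Continuous (fun h : ℝ => infDist (u + (h / s) • (u - p)) A - (s + h)) :=
    ((continuous_infDist_pt A).comp (by fun_prop)).sub (by fun_prop)
  have hcl : IsClosed {h : ℝ | 0 ≤ infDist (u + (h / s) • (u - p)) A - (s + h)} :=
    isClosed_le continuous_const hc
  have hsub : Set.Ioo 0 (τ - s) ⊆ {h : ℝ | 0 ≤ infDist (u + (h / s) • (u - p)) A - (s + h)} := by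
    intro h hh
    have := extend hAne hAcl τ hreach u p hp hup hpos h hh.1 (by linarith [hh.2])
    simp only [Set.mem_ofPred_eq]
    linarith
  have h1 := hcl.closure_subset_iff.2 hsub
  rw [closure_Ioo (by linarith)] at h1
  have := h1 (Set.right_mem_Icc.2 (by linarith))
  simp only [Set.mem_ofPred_eq] at this
  linarith

theorem third_bound (τ D S : ℝ) (hτ : 0 < τ) (hD : 0 ≤ D) (hS : 0 ≤ S)
    (h : D ^ 2 = τ ^ 2 - S ^ 2) :
    2 * τ * S ^ 2 / (τ + D) ≤ (S + ((Real.sqrt 2 - 1) / τ) * S ^ 2) ^ 2 := by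
  have hDτ : D ≤ τ := by nlinarith
  set r := Real.sqrt 2 with hr
  have hr2 : r ^ 2 = 2 := Real.sq_sqrt (by norm_num)
  have hr0 : 0 ≤ r := Real.sqrt_nonneg _
  have hr1 : 1 ≤ r := by nlinarith
  have hrlt : r < 2 := by nlinarith
  set e := Real.sqrt ((τ + D) / (2 * τ)) with he
  have he2 : e ^ 2 = (τ + D) / (2 * τ) := Real.sq_sqrt (by positivity)
  have hepos : 0 < e := Real.sqrt_pos.2 (by positivity)
  have hTD : τ + D = 2 * τ * e ^ 2 := by rw [he2]; field_simp
  set a := S / τ with ha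
  have hSa : S = τ * a := by rw [ha]; field_simp
  have ha0 : 0 ≤ a := by positivity
  have hD' : D = τ * (2 * e ^ 2 - 1) := by linarith
  have ha2 : a ^ 2 = 4 * e ^ 2 * (1 - e ^ 2) := by
    have : τ ^ 2 * (a ^ 2 - 4 * e ^ 2 * (1 - e ^ 2)) = 0 := by
      rw [hD', hSa] at h
      linear_combination h
    have h2 := (mul_eq_zero.1 this).resolve_left (by positivity)
    linarith
  have hehalf : 1 ≤ 2 * e ^ 2 := by
    by_contra hc
    push Not at hc
    nlinarith
  have hele : e ≤ 1 := by
    have : e ^ 2 ≤ 1 := by nlinarith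
    nlinarith
  have her : 1 ≤ r * e := by
    have : 1 ≤ (r * e) ^ 2 := by rw [mul_pow, hr2]; exact hehalf
    nlinarith [mul_nonneg hr0 hepos.le]
  have k1 : 1 - e ≤ (r - 1) ^ 2 * (1 + e) := by
    nlinarith
  have k2 : 1 - e ≤ 4 * (r - 1) ^ 2 * e ^ 4 * (1 + e) := by
    have h4 : 1 ≤ 4 * e ^ 4 := by nlinarith
    have : 0 ≤ (r - 1) ^ 2 * (1 + e) := by positivity
    nlinarith
  have k3 : 1 - e ≤ (r - 1) * e * a := by
    refine le_of_abs_le (abs_le_of_sq_le_sq ?_ (mul_nonneg (mul_nonneg (by linarith) hepos.le) ha0))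
    have : ((r - 1) * e * a) ^ 2 = (1 - e) * (4 * (r - 1) ^ 2 * e ^ 4 * (1 + e)) := by
      rw [mul_pow, ha2]; ring
    rw [this, sq]
    exact mul_le_mul_of_nonneg_left k2 (by linarith)
  have k4 : 1 ≤ e * (1 + (r - 1) * a) := by linarith
  have k5 : 1 ≤ (e * (1 + (r - 1) * a)) ^ 2 := one_le_pow₀ k4
  rw [div_le_iff₀ (by linarith), hTD]
  have : S + (r - 1) / τ * S ^ 2 = S * (1 + (r - 1) * a) := by
    rw [ha]; field_simp
  rw [this]
  calc 2 * τ * S ^ 2 = 2 * τ * S ^ 2 * 1 := by ring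
    _ ≤ 2 * τ * S ^ 2 * (e * (1 + (r - 1) * a)) ^ 2 := by gcongr
    _ = _ := by ring

/-- Bound on `‖x − π_A(u)‖` when `‖x − u‖ ≤ τ − d_A(x)` on a set of reach
at least `τ`, together with two further upper bounds on the bounding quantity. -/
theorem stmt11 (d : ℕ) (A : Set (EuclideanSpace ℝ (Fin d))) (hAne : A.Nonempty)
    (hAcl : IsClosed A) (τ : ℝ) (hτ : 0 < τ)
    (hreach : ∀ z : EuclideanSpace ℝ (Fin d), Metric.infDist z A < τ →
      ∃! p, p ∈ A ∧ dist z p = Metric.infDist z A)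
    (x u : EuclideanSpace ℝ (Fin d))
    (hxunp : ∃! p, p ∈ A ∧ dist x p = Metric.infDist x A)
    (huunp : ∃! p, p ∈ A ∧ dist u p = Metric.infDist u A)
    (hx : Metric.infDist x A < τ)
    (hclose : ‖x - u‖ ≤ τ - Metric.infDist x A)
    (B A₀ : ℝ) (hB : B = Metric.infDist x A * (2 * τ - Metric.infDist x A))
    (hA₀ : A₀ = ‖u - x‖ ^ 2 + B) :
    (∀ pu, pu ∈ A → dist u pu = Metric.infDist u A →
      ‖x - pu‖ ≤ Real.sqrt (2 * τ * A₀ / (τ + Real.sqrt (τ ^ 2 - A₀)) - B)) ∧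
    Real.sqrt (2 * τ * A₀ / (τ + Real.sqrt (τ ^ 2 - A₀)) - B) ≤
      Real.sqrt (τ * (2 * ‖u - x‖ ^ 2 + B) / (τ + Real.sqrt (τ ^ 2 - A₀))) ∧
    Real.sqrt (2 * τ * A₀ / (τ + Real.sqrt (τ ^ 2 - A₀)) - B) ≤
      Real.sqrt ((Real.sqrt A₀ + ((Real.sqrt 2 - 1) / τ) * A₀) ^ 2 - B) := by
  set r := Metric.infDist x A with hr
  have hr0 : 0 ≤ r := Metric.infDist_nonneg
  have hB0 : 0 ≤ B := by rw [hB]; exact mul_nonneg hr0 (by linarith)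
  have hnc : ‖u - x‖ = ‖x - u‖ := norm_sub_rev _ _
  set δ := ‖u - x‖ with hδ
  have hδ0 : 0 ≤ δ := norm_nonneg _
  have hδr : δ ≤ τ - r := by rw [hnc]; exact hclose
  have hA0 : 0 ≤ A₀ := by rw [hA₀]; positivity
  have hAτ : A₀ ≤ τ ^ 2 := by rw [hA₀, hB]; nlinarith
  set D := Real.sqrt (τ ^ 2 - A₀) with hD
  have hD0 : 0 ≤ D := Real.sqrt_nonneg _
  have hD2 : D ^ 2 = τ ^ 2 - A₀ := Real.sq_sqrt (by linarith)
  have hq : 2 * τ * A₀ / (τ + D) = 2 * τ * (τ - D) := by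
    rw [div_eq_iff (by linarith)]
    linear_combination (2 * τ) * hD2
  refine ⟨?_, ?_, ?_⟩
  · intro p hp hup
    apply Real.le_sqrt_of_sq_le
    rw [hq]
    set s := Metric.infDist u A with hs
    have hs0 : 0 ≤ s := Metric.infDist_nonneg
    have hsr : s ≤ r + δ := by
      have := Metric.infDist_le_infDist_add_dist (x := u) (y := x) (s := A)
      rwa [dist_eq_norm] at this
    rcases (show s ≤ τ by linarith).lt_or_eq with hsτ | hsτ
    · have key : (‖x - p‖ ^ 2 + B) * (τ - s) ≤ τ * (A₀ - s ^ 2) := by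
        rcases hs0.eq_or_lt with h0 | h0
        · rw [← h0, dist_eq_zero] at hup
          rw [← h0, ← hup, ← hnc, hA₀]
          apply le_of_eq; ring
        · have hext := extend_tau hAne hAcl τ hreach u p hp hup h0 hsτ
          rw [← hs] at hext
          set n := (1 / s) • (u - p) with hn
          have hups : u - p = s • n := by
            rw [hn, smul_smul, mul_one_div_cancel h0.ne', one_smul]
          have hnn : ‖n‖ = 1 := by
            rw [hn, norm_smul, ← dist_eq_norm, hup, Real.norm_of_nonneg (by positivity)]
            field_simp
          have hc : u + ((τ - s) / s) • (u - p) = p + τ • n := by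
            have : u = p + s • n := by rw [← hups]; abel
            rw [hups, smul_smul, div_mul_cancel₀ _ h0.ne']
            nth_rewrite 1 [this]
            rw [sub_smul]; abel
          rw [hc] at hext
          have h1 := Metric.infDist_le_infDist_add_dist (x := p + τ • n) (y := x) (s := A)
          rw [dist_comm, dist_eq_norm] at h1
          have h2 : τ - r ≤ ‖(x - p) - τ • n‖ := by
            have : (x - p) - τ • n = x - (p + τ • n) := by abel
            rw [this]; linarith
          have h3 : (τ - r) ^ 2 ≤ ‖(x - p) - τ • n‖ ^ 2 :=
            pow_le_pow_left₀ (by linarith) h2 2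
          have h4 : ‖(x - p) - s • n‖ ^ 2 = δ ^ 2 := by
            rw [← hups, hnc]; congr 2; abel
          rw [norm_sub_sq_real, norm_smul, hnn, real_inner_smul_right, Real.norm_eq_abs,
            mul_one, sq_abs] at h3 h4
          set w := inner ℝ (x - p) n with hw
          have h5 : 2 * τ * w ≤ ‖x - p‖ ^ 2 + B := by rw [hB]; linarith
          have h6 : s * (2 * τ * w) ≤ s * (‖x - p‖ ^ 2 + B) := by gcongr
          have h7 : s * (2 * τ * w) = τ * (‖x - p‖ ^ 2 + s ^ 2 - δ ^ 2) := by
            linear_combination (-τ) * h4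
          rw [hA₀]
          linarith
      have k2 : A₀ - s ^ 2 ≤ 2 * (τ - D) * (τ - s) := by
        nlinarith [sq_nonneg (τ - D - s)]
      have k3 : (‖x - p‖ ^ 2 + B) * (τ - s) ≤ (2 * τ * (τ - D)) * (τ - s) := by
        have : τ * (A₀ - s ^ 2) ≤ τ * (2 * (τ - D) * (τ - s)) := by gcongr
        linarith
      have := le_of_mul_le_mul_right k3 (by linarith)
      linarith
    · have hδe : δ = τ - r := by linarith
      have hDz : D = 0 := by
        have : D ^ 2 = 0 := by rw [hD2, hA₀, hB, hδe]; ring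
        exact pow_eq_zero_iff two_ne_zero |>.1 this
      obtain ⟨q, ⟨hqA, hxq⟩, -⟩ := hxunp
      have huq : dist u q = s := by
        apply le_antisymm _ (Metric.infDist_le_dist_of_mem hqA)
        have := dist_triangle u x q
        rw [dist_eq_norm u x, hxq] at this
        linarith
      have hpq : p = q := huunp.unique ⟨hp, hup⟩ ⟨hqA, huq⟩
      rw [hpq, ← dist_eq_norm, hxq, hDz, hB]
      nlinarith
  · apply Real.sqrt_le_sqrt
    have hTD : 0 < τ + D := by linarith
    rw [sub_le_iff_le_add, div_add' _ _ _ hTD.ne', div_le_div_iff_of_pos_right hTD, hA₀]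
    nlinarith [mul_nonneg hB0 hD0]
  · apply Real.sqrt_le_sqrt
    have h2 : Real.sqrt A₀ ^ 2 = A₀ := Real.sq_sqrt hA0
    have := third_bound τ D (Real.sqrt A₀) hτ hD0 (Real.sqrt_nonneg _) (by rw [h2, hD2])
    rw [h2] at this
    linarith
end

section
/- Let A ⊆ ℝ^d be a nonempty closed set with reach at least τ > 0 (every z with infDist(z, A) < τ has a unique nearest point in A). Let x_1, …, x_k ∈ ℝ^d with d_A(x_i) < τ for all i, let λ_1, …, λ_k ∈ [0,1] with Σ λ_i = 1, and set u := Σ_i λ_i x_i. Let x ∈ ℝ^d with d_A(x) < τ satisfy ‖x − x_i‖ < √( (τ − d_A(x))² + (τ − d_A(x_i))² ) for all i. Then u has a unique nearest point π_A(u) in A, and ‖x − π_A(u)‖ ≤ min{ √( Σ_i λ_i ( ‖x_i − x‖² + d_A(x_i)(2τ − d_A(x_i)) ) ), √( 2‖x − u‖² + d_A(x)(2τ − d_A(x)) ) }. -/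
open Metric in
lemma aux_step {E : Type*} [NormedAddCommGroup E] [InnerProductSpace ℝ E] [ProperSpace E]
    (A : Set E) (hne : A.Nonempty) (hcl : IsClosed A) (w p : E)
    (hp : p ∈ A) (hd : dist w p = infDist w A)
    (huniq : ∀ q, q ∈ A → dist w q = infDist w A → q = p)
    (hpos : 0 < infDist w A) (ε : ℝ) (hε : 0 < ε) (hε1 : ε < 1) (t0 : ℝ) (ht0 : 0 < t0) :
    ∃ w', dist w' w < t0 ∧ infDist w A + (1 - ε) * dist w' w ≤ infDist w' A ∧ w' ≠ w := by
  set δ := infDist w A with hδ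
  have hη : 0 < ε * δ := by positivity
  obtain ⟨ρ, hρ, hρq⟩ : ∃ ρ > 0, ∀ y q, dist y w < ρ → q ∈ A → dist y q = infDist y A →
      dist q p < ε * δ := by
    rcases (A \ ball p (ε * δ)).eq_empty_or_nonempty with hB | hB
    · refine ⟨1, one_pos, fun y q _ hq _ => ?_⟩
      by_contra h
      have : q ∈ A \ ball p (ε * δ) := ⟨hq, h⟩
      rw [hB] at this
      exact this
    · have hBc : IsClosed (A \ ball p (ε * δ)) := hcl.sdiff isOpen_ball
      obtain ⟨b, hb, hbd⟩ := hBc.exists_infDist_eq_dist hB w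
      have h1 : δ ≤ dist w b := infDist_le_dist_of_mem hb.1
      have h2 : δ ≠ dist w b := by
        intro h
        have := huniq b hb.1 h.symm
        apply hb.2
        rw [this]
        exact mem_ball_self hη
      have h3 : δ < dist w b := lt_of_le_of_ne h1 h2
      refine ⟨(dist w b - δ) / 2, by linarith, fun y q hy hq hyq => ?_⟩
      by_contra h
      have hqB : q ∈ A \ ball p (ε * δ) := ⟨hq, h⟩
      have h4 : infDist w (A \ ball p (ε * δ)) ≤ dist w q := infDist_le_dist_of_mem hqB
      have h5 : infDist y A ≤ dist y p := infDist_le_dist_of_mem hp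
      have h6 := dist_triangle w y q
      have h7 := dist_triangle y w p
      rw [dist_comm w y] at h6
      linarith
  set n : E := δ⁻¹ • (w - p) with hn
  have hwp : ‖w - p‖ = δ := by rw [← dist_eq_norm, hd]
  have hn1 : ‖n‖ = 1 := by
    rw [hn, norm_smul, hwp, Real.norm_of_nonneg (by positivity)]
    field_simp
  obtain ⟨t, ht, htm⟩ := exists_between (lt_min hρ ht0)
  have htρ := lt_of_lt_of_le htm (min_le_left _ _)
  have htt := lt_of_lt_of_le htm (min_le_right _ _)
  have hdt : dist (w + t • n) w = t := by
    rw [dist_eq_norm, add_sub_cancel_left, norm_smul, hn1, Real.norm_of_nonneg ht.le, mul_one]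
  refine ⟨w + t • n, by rw [hdt]; exact htt, ?_, ?_⟩
  · rw [hdt]
    obtain ⟨q, hq, hqd⟩ := hcl.exists_infDist_eq_dist hne (w + t • n)
    have hqp := hρq _ q (by rw [hdt]; exact htρ) hq hqd.symm
    rw [hqd]
    have h1 : δ ≤ ‖w - q‖ := by rw [← dist_eq_norm]; exact infDist_le_dist_of_mem hq
    have h2 : inner ℝ (w - q) n = δ - inner ℝ (q - p) n := by
      have : w - q = (w - p) - (q - p) := by abel
      rw [this, inner_sub_left]
      congr 1
      rw [hn, inner_smul_right, real_inner_self_eq_norm_sq, hwp]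
      field_simp
    have h3 : inner ℝ (q - p) n ≤ ε * δ := by
      have := real_inner_le_norm (q - p) n
      rw [hn1, mul_one, ← dist_eq_norm] at this
      linarith
    have h4 : dist (w + t • n) q ^ 2 = ‖w - q‖ ^ 2 + 2 * (t * inner ℝ (w - q) n) + t ^ 2 := by
      rw [dist_eq_norm, show w + t • n - q = (w - q) + t • n by abel, norm_add_sq_real,
        inner_smul_right, norm_smul, hn1, Real.norm_of_nonneg ht.le, mul_one]
    refine (abs_le_of_sq_le_sq' ?_ dist_nonneg).2
    rw [h4, h2]
    have h5 : δ ^ 2 ≤ ‖w - q‖ ^ 2 := by gcongr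
    have h6 := mul_le_mul_of_nonneg_left h3 ht.le
    have h7 : (1 - ε) ^ 2 * t ^ 2 ≤ 1 * t ^ 2 := by
      gcongr
      nlinarith
    nlinarith
  · intro h
    rw [h, dist_self] at hdt
    linarith

open Metric in
lemma aux_flow {E : Type*} [NormedAddCommGroup E] [InnerProductSpace ℝ E] [ProperSpace E]
    (A : Set E) (hne : A.Nonempty) (hcl : IsClosed A) (τ : ℝ)
    (hreach : ∀ z : E, infDist z A < τ → ∃! p, p ∈ A ∧ dist z p = infDist z A)
    (z : E) (hpos : 0 < infDist z A) (s : ℝ) (hs : 0 ≤ s) (hsτ : infDist z A + s < τ)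
    (ε : ℝ) (hε : 0 < ε) (hε1 : ε < 1) :
    ∃ w ∈ closedBall z s, infDist z A + (1 - ε) * s ≤ infDist w A := by
  have hcont : Continuous (fun w : E => infDist w A) := continuous_infDist_pt A
  set K : Set E := closedBall z s ∩ {w | infDist z A + (1 - ε) * dist w z ≤ infDist w A} with hK
  have hKc : IsCompact K := (isCompact_closedBall z s).inter_right
    (isClosed_le (by fun_prop) hcont)
  have hzK : z ∈ K := ⟨mem_closedBall_self hs, by simp⟩
  obtain ⟨w, hwK, hmax⟩ := hKc.exists_isMaxOn ⟨z, hzK⟩ hcont.continuousOn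
  have hw1 : dist w z ≤ s := hwK.1
  have hw2 : infDist z A + (1 - ε) * dist w z ≤ infDist w A := hwK.2
  rcases hw1.eq_or_lt with h | h
  · exact ⟨w, hwK.1, by rw [← h]; exact hw2⟩
  · exfalso
    have h1 : infDist w A ≤ infDist z A + dist w z := infDist_le_infDist_add_dist
    obtain ⟨p, ⟨hp, hpd⟩, hpu⟩ := hreach w (by linarith)
    have h0 : 0 ≤ (1 - ε) * dist w z := mul_nonneg (by linarith) dist_nonneg
    obtain ⟨w', h2, h3, h4⟩ := aux_step A hne hcl w p hp hpd (fun q hq hq' => hpu q ⟨hq, hq'⟩)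
      (by linarith) ε hε hε1 (s - dist w z) (by linarith)
    have h5 := dist_triangle w' w z
    have h6 : w' ∈ K := by
      refine ⟨?_, ?_⟩
      · rw [mem_closedBall]; linarith
      · show infDist z A + (1 - ε) * dist w' z ≤ infDist w' A
        have := mul_le_mul_of_nonneg_left h5 (by linarith : 0 ≤ 1 - ε)
        linarith
    have h7 : infDist w' A ≤ infDist w A := hmax h6
    have h8 : 0 < (1 - ε) * dist w' w := mul_pos (by linarith) (dist_pos.2 h4)
    linarith

open Metric in
lemma aux_federer {E : Type*} [NormedAddCommGroup E] [InnerProductSpace ℝ E] [ProperSpace E]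
    (A : Set E) (hne : A.Nonempty) (hcl : IsClosed A) (τ : ℝ)
    (hreach : ∀ z : E, infDist z A < τ → ∃! p, p ∈ A ∧ dist z p = infDist z A)
    (z p : E) (hpos : 0 < infDist z A) (hlt : infDist z A < τ)
    (hp : p ∈ A) (hpd : dist z p = infDist z A) :
    ∃ n : E, ‖n‖ = 1 ∧ z = p + infDist z A • n ∧ τ ≤ infDist (p + τ • n) A := by
  have hcont : Continuous (fun w : E => infDist w A) := continuous_infDist_pt A
  set δ := infDist z A with hδ
  have hzp : ‖z - p‖ = δ := by rw [← dist_eq_norm, hpd]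
  have hn1 : ‖δ⁻¹ • (z - p)‖ = 1 := by
    rw [norm_smul, hzp, Real.norm_of_nonneg (by positivity)]
    field_simp
  refine ⟨δ⁻¹ • (z - p), hn1, ?_, ?_⟩
  · rw [smul_smul, mul_inv_cancel₀ hpos.ne', one_smul]; abel
  set n : E := δ⁻¹ • (z - p) with hn
  have hzn : z - p = δ • n := by
    rw [hn, smul_smul, mul_inv_cancel₀ hpos.ne', one_smul]
  have key : ∀ s, 0 ≤ s → δ + s < τ → δ + s ≤ infDist (p + (δ + s) • n) A := by
    intro s hs hsτ
    obtain ⟨w, hwK, hmax⟩ := (isCompact_closedBall z s).exists_isMaxOn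
      ⟨z, mem_closedBall_self hs⟩ hcont.continuousOn
    have h1 : δ + s ≤ infDist w A := by
      by_contra! hc
      have hs0 : 0 < s := by
        rcases hs.eq_or_lt with h | h
        · subst h
          have : w = z := by simpa using hwK
          rw [this] at hc
          linarith
        · exact h
      obtain ⟨e, he, he'⟩ := exists_between (lt_min one_pos
        (div_pos (by linarith : 0 < δ + s - infDist w A) hs0))
      obtain ⟨v, hv, hv'⟩ := aux_flow A hne hcl τ hreach z hpos s hs hsτ e he
        (lt_of_lt_of_le he' (min_le_left _ _))
      have h2 : infDist v A ≤ infDist w A := hmax hv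
      have h3 := (lt_div_iff₀ hs0).1 (lt_of_lt_of_le he' (min_le_right _ _))
      nlinarith
    have hpA : infDist w A ≤ ‖w - p‖ := by
      rw [← dist_eq_norm]
      exact infDist_le_dist_of_mem hp
    have hwz : ‖w - z‖ ≤ s := by rw [← dist_eq_norm]; exact hwK
    have h2 : ‖w - p‖ ^ 2 = ‖w - z‖ ^ 2 + 2 * (δ * inner ℝ (w - z) n) + δ ^ 2 := by
      rw [show w - p = (w - z) + (z - p) by abel, norm_add_sq_real, hzp, hzn, inner_smul_right]
    have h3 : (δ + s) ^ 2 ≤ ‖w - p‖ ^ 2 := by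
      have := h1.trans hpA
      gcongr
    have h4 : ‖w - z‖ ^ 2 ≤ s ^ 2 := by gcongr
    have h5 : s ≤ inner ℝ (w - z) n := by
      by_contra! hc
      have := mul_lt_mul_of_pos_left hc hpos
      nlinarith
    have h6 : ‖w - z - s • n‖ ^ 2 ≤ 0 := by
      rw [norm_sub_sq_real, inner_smul_right, norm_smul, hn1, Real.norm_of_nonneg hs]
      nlinarith [mul_le_mul_of_nonneg_left h5 hs]
    have h7 : w - z - s • n = 0 := by
      rw [← norm_eq_zero]
      exact pow_eq_zero_iff (two_ne_zero) |>.1 (le_antisymm h6 (sq_nonneg _))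
    have h8 : w = p + (δ + s) • n := by
      have h9 : w = (w - z - s • n) + (z - p) + p + s • n := by abel
      rw [h9, h7, hzn, add_smul]; abel
    rw [← h8]; exact h1
  apply le_of_forall_pos_le_add
  intro e he
  obtain ⟨s, hs0, hs⟩ : ∃ s, 0 ≤ s ∧ s < τ - δ ∧ τ - δ - s ≤ e / 2 := by
    refine ⟨max 0 (τ - δ - e / 2), le_max_left _ _, max_lt (by linarith) (by linarith), ?_⟩
    linarith [le_max_right 0 (τ - δ - e / 2)]
  have h1 := key s hs0 (by linarith)
  have h2 : infDist (p + (δ + s) • n) A ≤ infDist (p + τ • n) A +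
      dist (p + (δ + s) • n) (p + τ • n) := infDist_le_infDist_add_dist
  have h3 : dist (p + (δ + s) • n) (p + τ • n) = τ - δ - s := by
    rw [dist_eq_norm, show p + (δ + s) • n - (p + τ • n) = (-(τ - δ - s)) • n by module,
      norm_smul, hn1, norm_neg, Real.norm_of_nonneg (by linarith), mul_one]
  linarith

/-- For `u = Σ λ_i x_i` with each `‖x − x_i‖ < √((τ−d_A(x))² + (τ−d_A(x_i))²)`,
`u` has a unique nearest point in `A` and its distance to `x` is bounded by the minimum of
two quantities. -/
theorem stmt12 (d k : ℕ) (A : Set (EuclideanSpace ℝ (Fin d))) (hAne : A.Nonempty)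
    (hAcl : IsClosed A) (τ : ℝ) (hτ : 0 < τ)
    (hreach : ∀ z : EuclideanSpace ℝ (Fin d), Metric.infDist z A < τ →
      ∃! p, p ∈ A ∧ dist z p = Metric.infDist z A)
    (x' : Fin k → EuclideanSpace ℝ (Fin d)) (hx' : ∀ i, Metric.infDist (x' i) A < τ)
    (lam : Fin k → ℝ) (hlam : ∀ i, lam i ∈ Set.Icc (0 : ℝ) 1) (hsum : ∑ i, lam i = 1)
    (u : EuclideanSpace ℝ (Fin d)) (hu : u = ∑ i, lam i • x' i)
    (x : EuclideanSpace ℝ (Fin d)) (hx : Metric.infDist x A < τ)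
    (hclose : ∀ i, ‖x - x' i‖ < Real.sqrt ((τ - Metric.infDist x A) ^ 2 +
      (τ - Metric.infDist (x' i) A) ^ 2)) :
    (∃! p, p ∈ A ∧ dist u p = Metric.infDist u A) ∧
    ∀ p, p ∈ A → dist u p = Metric.infDist u A →
      ‖x - p‖ ≤ min
        (Real.sqrt (∑ i, lam i * (‖x' i - x‖ ^ 2 +
          Metric.infDist (x' i) A * (2 * τ - Metric.infDist (x' i) A))))
        (Real.sqrt (2 * ‖x - u‖ ^ 2 +
          Metric.infDist x A * (2 * τ - Metric.infDist x A))) := by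
  classical
  set D := fun y => Metric.infDist y A with hD
  have hD0 : ∀ y, 0 ≤ D y := fun y => Metric.infDist_nonneg
  -- acute angle at the centre of any ball of radius τ avoiding A
  have acute : ∀ c, τ ≤ D c → ∀ i, 0 < inner ℝ (x - c) (x' i - c) := by
    intro c hc i
    have g : ∀ y, D y < τ → (τ - D y) ^ 2 ≤ ‖y - c‖ ^ 2 := by
      intro y hy
      have : D c ≤ D y + dist c y := Metric.infDist_le_infDist_add_dist
      rw [dist_comm, dist_eq_norm] at this
      have h0 : 0 ≤ τ - D y := by linarith
      have h1 : τ - D y ≤ ‖y - c‖ := by linarith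
      gcongr
    have h1 := g x hx
    have h2 := g (x' i) (hx' i)
    have h3 := (Real.lt_sqrt (norm_nonneg _)).1 (hclose i)
    have h4 : ‖x - x' i‖ ^ 2 = ‖x - c‖ ^ 2 - 2 * inner ℝ (x - c) (x' i - c) + ‖x' i - c‖ ^ 2 := by
      rw [← norm_sub_sq_real]; congr 2; abel
    simp only [hD] at h1 h2
    linarith
  have hl0 : ∀ i, 0 ≤ lam i := fun i => (hlam i).1
  have huc : ∀ c, u - c = ∑ i, lam i • (x' i - c) := by
    intro c
    simp only [smul_sub, Finset.sum_sub_distrib, ← Finset.sum_smul, hsum, one_smul, hu]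
  have acute' : ∀ c, τ ≤ D c → 0 < inner ℝ (x - c) (u - c) := by
    intro c hc
    rw [huc c, inner_sum]
    obtain ⟨j, hj⟩ : ∃ j, 0 < lam j := by
      by_contra! h
      have : ∑ i, lam i ≤ 0 := Finset.sum_nonpos fun i _ => h i
      linarith
    apply Finset.sum_pos'
    · intro i _
      rw [inner_smul_right]
      exact mul_nonneg (hl0 i) (acute c hc i).le
    · refine ⟨j, Finset.mem_univ _, ?_⟩
      rw [inner_smul_right]
      exact mul_pos hj (acute c hc j)
  have hDu : D u < τ := by
    by_contra! h
    have := acute' u h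
    simp at this
  -- variance identity
  have var : ∀ c, ∑ i, lam i * ‖x' i - c‖ ^ 2 = ‖u - c‖ ^ 2 + ∑ i, lam i * ‖x' i - u‖ ^ 2 := by
    intro c
    have e : ∀ i, lam i * ‖x' i - c‖ ^ 2 = lam i * ‖x' i - u‖ ^ 2 +
        2 * inner ℝ (lam i • (x' i - u)) (u - c) + lam i * ‖u - c‖ ^ 2 := by
      intro i
      rw [show x' i - c = (x' i - u) + (u - c) by abel, norm_add_sq_real, real_inner_smul_left]
      ring
    rw [Finset.sum_congr rfl fun i _ => e i, Finset.sum_add_distrib, Finset.sum_add_distrib,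
      ← Finset.mul_sum, ← sum_inner, ← huc u, ← Finset.sum_mul, hsum]
    simp
    ring
  refine ⟨hreach u hDu, fun p hp hpd => ?_⟩
  have split : ∑ i, lam i * (‖x' i - x‖ ^ 2 + D (x' i) * (2 * τ - D (x' i))) =
      ‖u - x‖ ^ 2 + ∑ i, lam i * ‖x' i - u‖ ^ 2 + ∑ i, lam i * (D (x' i) * (2 * τ - D (x' i))) := by
    rw [← var x, ← Finset.sum_add_distrib]
    exact Finset.sum_congr rfl fun i _ => by ring
  have hV : 0 ≤ ∑ i, lam i * ‖x' i - u‖ ^ 2 :=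
    Finset.sum_nonneg fun i _ => mul_nonneg (hl0 i) (sq_nonneg _)
  have hxx : 0 ≤ D x * (2 * τ - D x) := mul_nonneg (hD0 x) (by simp only [hD]; linarith)
  apply le_min
  all_goals apply Real.le_sqrt_of_sq_le
  all_goals rcases (hD0 u).eq_or_lt with h0 | h0
  · have hup : u = p := by
      rw [← dist_eq_zero, hpd]; exact h0.symm
    have : 0 ≤ ∑ i, lam i * (D (x' i) * (2 * τ - D (x' i))) :=
      Finset.sum_nonneg fun i _ => mul_nonneg (hl0 i)
        (mul_nonneg (hD0 _) (by have := hx' i; simp only [hD]; linarith))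
    rw [split, ← hup, norm_sub_rev]
    linarith
  · obtain ⟨n, hn1, hun, hc⟩ := aux_federer A hAne hAcl τ hreach u p h0 hDu hp hpd
    change u = p + D u • n at hun
    have ha := acute' _ hc
    rw [split]
    have h1 : ∑ i, lam i * (τ - D (x' i)) ^ 2 ≤ ∑ i, lam i * ‖x' i - (p + τ • n)‖ ^ 2 := by
      apply Finset.sum_le_sum
      intro i _
      apply mul_le_mul_of_nonneg_left _ (hl0 i)
      have h2 : D (p + τ • n) ≤ D (x' i) + dist (p + τ • n) (x' i) :=
        Metric.infDist_le_infDist_add_dist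
      rw [dist_comm, dist_eq_norm] at h2
      have h3 := hx' i
      have h4 : 0 ≤ τ - D (x' i) := by simp only [hD]; linarith
      have h5 : τ - D (x' i) ≤ ‖x' i - (p + τ • n)‖ := by simp only [hD] at h2 ⊢; linarith
      gcongr
    have h2 : ∑ i, lam i * (D (x' i) * (2 * τ - D (x' i))) =
        τ ^ 2 - ∑ i, lam i * (τ - D (x' i)) ^ 2 := by
      have : τ ^ 2 = ∑ i, lam i * τ ^ 2 := by rw [← Finset.sum_mul, hsum, one_mul]
      rw [this, ← Finset.sum_sub_distrib]
      exact Finset.sum_congr rfl fun i _ => by ring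
    rw [var] at h1
    set δ := D u with hδ
    have e1 : u - (p + τ • n) = (-(τ - δ)) • n := by
      nth_rw 1 [hun]; module
    have e2 : x - (p + τ • n) = (x - u) + (-(τ - δ)) • n := by
      rw [← e1]; abel
    have e3 : x - p = (x - u) + δ • n := by
      nth_rw 1 [hun]; abel
    rw [e2, e1, inner_smul_right, inner_add_left, real_inner_smul_left,
      real_inner_self_eq_norm_sq, hn1] at ha
    have e4 : ‖u - (p + τ • n)‖ ^ 2 = (τ - δ) ^ 2 := by
      rw [e1, norm_smul, hn1, mul_one, Real.norm_eq_abs, sq_abs]; ring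
    have e5 : ‖x - p‖ ^ 2 = ‖x - u‖ ^ 2 + 2 * (δ * inner ℝ (x - u) n) + δ ^ 2 := by
      rw [e3, norm_add_sq_real, inner_smul_right, norm_smul, hn1, mul_one, Real.norm_eq_abs, sq_abs]
    have e6 : inner ℝ (x - u) n ≤ τ - δ := by
      by_contra! hcon
      nlinarith
    rw [e5, h2, norm_sub_rev u x]
    rw [e4] at h1
    nlinarith [mul_le_mul_of_nonneg_left e6 h0.le]
  · have hup : u = p := by
      rw [← dist_eq_zero, hpd]; exact h0.symm
    rw [← hup]
    have := sq_nonneg ‖x - u‖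
    simp only [hD] at hxx
    linarith
  · obtain ⟨n, hn1, hun, hc⟩ := aux_federer A hAne hAcl τ hreach u p h0 hDu hp hpd
    change u = p + D u • n at hun
    have ha := acute' _ hc
    have h1 : (τ - D x) ^ 2 ≤ ‖x - (p + τ • n)‖ ^ 2 := by
      have h2 : D (p + τ • n) ≤ D x + dist (p + τ • n) x :=
        Metric.infDist_le_infDist_add_dist
      rw [dist_comm, dist_eq_norm] at h2
      have h4 : 0 ≤ τ - D x := by simp only [hD]; linarith
      have h5 : τ - D x ≤ ‖x - (p + τ • n)‖ := by simp only [hD] at h2 ⊢; linarith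
      gcongr
    change _ ≤ 2 * ‖x - u‖ ^ 2 + D x * (2 * τ - D x)
    set δ := D u with hδ
    have e1 : u - (p + τ • n) = (-(τ - δ)) • n := by
      nth_rw 1 [hun]; module
    have e2 : x - (p + τ • n) = (x - u) + (-(τ - δ)) • n := by
      rw [← e1]; abel
    have e3 : x - p = (x - u) + δ • n := by
      nth_rw 1 [hun]; abel
    rw [e2, e1, inner_smul_right, inner_add_left, real_inner_smul_left,
      real_inner_self_eq_norm_sq, hn1] at ha
    rw [e2, norm_add_sq_real, inner_smul_right, norm_smul, hn1, mul_one, Real.norm_eq_abs,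
      sq_abs] at h1
    have e5 : ‖x - p‖ ^ 2 = ‖x - u‖ ^ 2 + 2 * (δ * inner ℝ (x - u) n) + δ ^ 2 := by
      rw [e3, norm_add_sq_real, inner_smul_right, norm_smul, hn1, mul_one, Real.norm_eq_abs, sq_abs]
    have e6 : inner ℝ (x - u) n ≤ τ - δ := by
      by_contra! hcon
      nlinarith
    rw [e5]
    generalize inner ℝ (x - u) n = a at *
    have hy := sq_nonneg ‖x - u‖
    rcases le_total a (-δ / 2) with h | h
    · nlinarith [mul_le_mul_of_nonneg_left h h0.le]
    · have h9 : 0 ≤ 2 * (τ - 2 * δ) * a + 2 * δ * (τ - δ) := by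
        rcases le_total (2 * δ) τ with h' | h'
        · nlinarith [mul_le_mul_of_nonneg_left h (by linarith : 0 ≤ τ - 2 * δ)]
        · nlinarith [mul_le_mul_of_nonneg_left e6 (by linarith : 0 ≤ 2 * δ - τ)]
      nlinarith
end
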